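/- Let w ≥ 2, let ≺ be an admissible linear order on the symbols on {1,…,n}, and consider the induced discrete vector field on desc(n,w). Then every critical symbol e of desc(n,w) satisfies: (1) whenever two consecutive blocks of e are both singletons, their entries are in decreasing order; and (2) every non-singleton block of e has exactly w elements and is a follower. -/

import Mathlib

/-- A symbol on {1,…,n}: a finite sequence of nonempty blocks in which every
element of {1,…,n} appears exactly once.  We encode the condition "each block
is nonempty and each element of {1,…,n} appears exactly once among all blocks"
by requiring the concatenation (flatten) of the blocks to be a permutation of the
list [1, 2, …, n]. -/
def IsSymbolOn (n : ℕ) (L : List (List ℕ)) : Prop :=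
  (∀ b ∈ L, b ≠ []) ∧ L.flatten.Perm (List.range' 1 n)

/-- The symbols on {1,…,n}. -/
def SymbolOn (n : ℕ) : Type := {L : List (List ℕ) // IsSymbolOn n L}

/-- The `i`-th block (0-indexed) of a list of blocks; junk value `[]` if out of range. -/
def fblock (L : List (List ℕ)) (i : ℕ) : List ℕ := L.getD i []

/-- The `i`-th block of `L` is a follower: the preceding block is a singleton whose
element is less than every element of block `i`. -/
def IsFollower (L : List (List ℕ)) (i : ℕ) : Prop :=
  ∃ j, i = j + 1 ∧ ∃ a, fblock L j = [a] ∧ ∀ x ∈ fblock L i, a < x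

/-- The first element of a block (junk value `0` for the empty list). -/
def headL (l : List ℕ) : ℕ := l.headD 0

/-- A relation `r` on the symbols on {1,…,n} is admissible if, whenever symbols α and β
agree in blocks `0,…,i-1` and differ in block `i`, conditions (1)–(4) hold. -/
def Admissible (n : ℕ) (r : SymbolOn n → SymbolOn n → Prop) : Prop :=
  ∀ α β : SymbolOn n, ∀ i : ℕ,
    (∀ k < i, fblock α.1 k = fblock β.1 k) → fblock α.1 i ≠ fblock β.1 i →
      ((IsFollower α.1 i → IsFollower β.1 i →
          (fblock α.1 i).length < (fblock β.1 i).length → r α β) ∧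
       (¬IsFollower α.1 i → ¬IsFollower β.1 i →
          headL (fblock β.1 i) < headL (fblock α.1 i) → r α β) ∧
       (¬IsFollower α.1 i → ¬IsFollower β.1 i →
          headL (fblock α.1 i) = headL (fblock β.1 i) →
          (fblock α.1 i).length < (fblock β.1 i).length → r α β) ∧
       (IsFollower α.1 i → ¬IsFollower β.1 i → r α β))

/-- `l` is a shuffle of `A` and `B`: an interleaving of the two sequences that
preserves the relative order of the entries of `A` and of the entries of `B`.
(For lists with no duplicate entries this is equivalent to: `A` and `B` are both
subsequences of `l` and the concatenation `A ++ B` is a permutation of `l`.) -/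
def IsShuffle (A B l : List ℕ) : Prop :=
  A.Sublist l ∧ B.Sublist l ∧ (A ++ B).Perm l

/-- `f` is a face of `g`: `g` is obtained from `f` by replacing two consecutive
blocks `A`, `B` of `f` by a single block which is a shuffle of `A` and `B`. -/
def IsFaceL (f g : List (List ℕ)) : Prop :=
  ∃ k, k < g.length ∧ ∃ A B,
    f = g.take k ++ [A, B] ++ g.drop (k + 1) ∧ IsShuffle A B (fblock g k)

/-- Given a linear order `r` and a set `X` of symbols closed under faces, the
induced discrete vector field pairs `f` with `g` exactly when `f` is the
`r`-greatest face of `g` and `g` is the `r`-least coface of `f` among cofaces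
of `f` lying in `X`. -/
def Paired (n : ℕ) (r : SymbolOn n → SymbolOn n → Prop) (X : Set (SymbolOn n))
    (f g : SymbolOn n) : Prop :=
  f ∈ X ∧ g ∈ X ∧ IsFaceL f.1 g.1 ∧
    (∀ f' : SymbolOn n, IsFaceL f'.1 g.1 → f' = f ∨ r f' f) ∧
    (∀ g' : SymbolOn n, g' ∈ X → IsFaceL f.1 g'.1 → g' = g ∨ r g g')

/-- A symbol of `X` is critical if it belongs to no pair of the induced
discrete vector field. -/
def Critical (n : ℕ) (r : SymbolOn n → SymbolOn n → Prop) (X : Set (SymbolOn n))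
    (e : SymbolOn n) : Prop :=
  e ∈ X ∧ (∀ g, ¬ Paired n r X e g) ∧ (∀ f, ¬ Paired n r X f e)

/-- The symbols of cell(n,w): all blocks have at most `w` elements. -/
def cellSet (n w : ℕ) : Set (SymbolOn n) := {e | ∀ b ∈ e.1, b.length ≤ w}

/-- The symbols of desc(n,w): all blocks have at most `w` elements and the
entries of every block are strictly decreasing. -/
def descSet (n w : ℕ) : Set (SymbolOn n) :=
  {e | ∀ b ∈ e.1, b.length ≤ w ∧ b.Chain' (· > ·)}

/-!
STATEMENT 11: Let w ≥ 2, let ≺ be an admissible linear order on the symbols on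
{1,…,n}, and consider the induced discrete vector field on desc(n,w).  Then
every critical symbol e of desc(n,w) satisfies: (1) whenever two consecutive
blocks of e are both singletons, their entries are in decreasing order; and
(2) every non-singleton block of e has exactly w elements and is a follower.
-/

theorem fblock_append_left {P Q : List (List ℕ)} {j : ℕ} (h : j < P.length) :
    fblock (P ++ Q) j = fblock P j := by
  simp [fblock, List.getElem?_append_left h]

theorem fblock_append_length (P Q : List (List ℕ)) (b : List ℕ) :
    fblock (P ++ b :: Q) P.length = b := by
  simp [fblock]

theorem fblock_append_length_succ (P Q : List (List ℕ)) (b c : List ℕ) :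
    fblock (P ++ b :: c :: Q) (P.length + 1) = c := by
  simp [fblock]

theorem take_append_fblock_cons_drop {L : List (List ℕ)} {i : ℕ} (h : i < L.length) :
    L.take i ++ fblock L i :: L.drop (i + 1) = L := by
  simp [fblock, List.getElem?_eq_getElem h]

theorem fblock_mem {L : List (List ℕ)} {i : ℕ} (h : i < L.length) : fblock L i ∈ L := by
  simp [fblock, List.getElem?_eq_getElem h]

theorem lt_length_of_fblock_ne_nil {L : List (List ℕ)} {i : ℕ} (h : fblock L i ≠ []) :
    i < L.length := by
  by_contra hi
  exact h (by simp [fblock, List.getElem?_eq_none (not_lt.mp hi)])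

/-- A face relation in terms of a common prefix and suffix. -/
theorem IsFaceL.exists_eq {f g : List (List ℕ)} (h : IsFaceL f g) :
    ∃ P A B C S, f = P ++ A :: B :: S ∧ g = P ++ C :: S ∧ IsShuffle A B C := by
  obtain ⟨k, hk, A, B, rfl, hs⟩ := h
  exact ⟨g.take k, A, B, fblock g k, g.drop (k + 1), by simp,
    (take_append_fblock_cons_drop hk).symm, hs⟩

theorem isFaceL_append {A B C : List ℕ} (P S : List (List ℕ)) (h : IsShuffle A B C) :
    IsFaceL (P ++ A :: B :: S) (P ++ C :: S) :=
  ⟨P.length, by simp, A, B, by simp, by rwa [fblock_append_length]⟩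

theorem IsFollower.mono {L L' : List (List ℕ)} {i : ℕ} (hL : IsFollower L i)
    (h : ∀ k < i, fblock L k = fblock L' k)
    (hb : ∀ x ∈ fblock L' i, ∃ y ∈ fblock L i, y ≤ x) : IsFollower L' i := by
  obtain ⟨j, rfl, a, ha, hlt⟩ := hL
  refine ⟨j, rfl, a, by rw [← h j (by omega), ha], fun x hx => ?_⟩
  obtain ⟨y, hy, hyx⟩ := hb x hx
  exact (hlt y hy).trans_le hyx

theorem isFollower_congr {L L' : List (List ℕ)} {i : ℕ}
    (h : ∀ k ≤ i, fblock L k = fblock L' k) : IsFollower L i ↔ IsFollower L' i :=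
  ⟨fun hf => hf.mono (fun k hk => h k hk.le) fun x hx => ⟨x, h i le_rfl ▸ hx, le_rfl⟩,
    fun hf => hf.mono (fun k hk => (h k hk.le).symm) fun x hx => ⟨x, h i le_rfl ▸ hx, le_rfl⟩⟩

/-- The blocks allowed in critical symbols: followers with `w` elements, and singletons
which are not followers. -/
def IsRigid (w : ℕ) (L : List (List ℕ)) (i : ℕ) : Prop :=
  (IsFollower L i ∧ (fblock L i).length = w) ∨ (¬IsFollower L i ∧ (fblock L i).length = 1)

theorem isRigid_congr {w : ℕ} {L L' : List (List ℕ)} {i : ℕ}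
    (h : ∀ k ≤ i, fblock L k = fblock L' k) : IsRigid w L i ↔ IsRigid w L' i := by
  rw [IsRigid, IsRigid, isFollower_congr h, h i le_rfl]

theorem isShuffle_append_singleton (a : ℕ) (B : List ℕ) : IsShuffle [a] B (B ++ [a]) :=
  ⟨by simp, by simp, by simpa using (List.perm_append_singleton a B).symm⟩

/-- Splitting `B ++ [a]` with `a` below all of `B`: either the first part has head above `a`,
or the splitting is `[a]`, `B`. -/
theorem lt_headL_or_eq_of_isShuffle {A A' B : List ℕ} {a : ℕ} (hA : A ≠ [])
    (hB : ∀ x ∈ B, a < x) (h : IsShuffle A A' (B ++ [a])) :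
    a < headL A ∨ (A = [a] ∧ A' = B) := by
  obtain ⟨h1, h2, h3⟩ := h
  obtain ⟨A1, A2, rfl, hA1, hA2⟩ := List.sublist_append_iff.mp h1
  rcases A1 with _ | ⟨x, A1⟩
  · right
    rcases List.sublist_singleton.mp hA2 with rfl | rfl
    · simp at hA
    · refine ⟨rfl, ?_⟩
      have hp : A'.Perm B := by
        have := h3.trans (List.perm_append_singleton a B)
        simpa using this
      obtain ⟨C1, C2, rfl, hC1, hC2⟩ := List.sublist_append_iff.mp h2
      rcases List.sublist_singleton.mp hC2 with rfl | rfl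
      · exact (by simpa using hC1 : (C1 ++ []).Sublist B).eq_of_length hp.length_eq
      · exact absurd (hB a (hp.subset (by simp))) (lt_irrefl a)
  · left
    exact hB x (hA1.subset (by simp))

theorem eq_of_perm_of_isChain_gt {C D : List ℕ} (h : C.Perm D) (hC : C.IsChain (· > ·))
    (hD : D.IsChain (· > ·)) : C = D :=
  h.eq_of_pairwise (fun _ _ _ _ h1 h2 => absurd h1 h2.asymm)
    (List.isChain_iff_pairwise.mp hC) (List.isChain_iff_pairwise.mp hD)

section Pairing

variable {n w : ℕ} {r : SymbolOn n → SymbolOn n → Prop} {f g : SymbolOn n}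
  {P S : List (List ℕ)} {a : ℕ} {B : List ℕ}

theorem face_eq_or_lt (hadm : Admissible n r)
    (hf : f.1 = P ++ [a] :: B :: S) (hg : g.1 = P ++ (B ++ [a]) :: S)
    (hB : ∀ x ∈ B, a < x) (hna : ¬IsFollower f.1 P.length)
    (hP : ∀ k < P.length, IsRigid w f.1 k) {f' : SymbolOn n} (h : IsFaceL f'.1 g.1) :
    f' = f ∨ r f' f := by
  obtain ⟨P', A, A', C, S', hf', hg', hs⟩ := h.exists_eq
  have hB0 : B ≠ [] := f.2.1 B (by simp [hf])
  have hA : A ≠ [] := f'.2.1 A (by simp [hf'])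
  have hA' : A' ≠ [] := f'.2.1 A' (by simp [hf'])
  have hgg := hg.symm.trans hg'
  have hfa : fblock f.1 P.length = [a] := by rw [hf, fblock_append_length]
  have hgP : fblock g.1 P.length = B ++ [a] := by rw [hg, fblock_append_length]
  have hgP' : fblock g.1 P'.length = C := by rw [hg', fblock_append_length]
  have hfP' : fblock f'.1 P'.length = A := by rw [hf', fblock_append_length]
  have agree : ∀ k < P.length, fblock f.1 k = fblock g.1 k := fun k hk => by
    rw [hf, hg, fblock_append_left hk, fblock_append_left hk]
  have agree' : ∀ k < P'.length, fblock f'.1 k = fblock g.1 k := fun k hk => by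
    rw [hf', hg', fblock_append_left hk, fblock_append_left hk]
  have key : P.length ≤ P'.length → a < headL (fblock f'.1 P.length) → r f' f := by
    intro hle hlt
    have hag : ∀ k < P.length, fblock f'.1 k = fblock f.1 k := fun k hk => by
      rw [agree' k (by omega), agree k hk]
    have hne : fblock f'.1 P.length ≠ fblock f.1 P.length := by
      intro h
      rw [h, hfa] at hlt
      exact lt_irrefl _ hlt
    obtain ⟨-, h2, -, h4⟩ := hadm f' f P.length hag hne
    by_cases hfol : IsFollower f'.1 P.length
    · exact h4 hfol hna
    · exact h2 hfol hna (by rw [hfa]; exact hlt)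
  rcases lt_trichotomy P'.length P.length with hlt | heq | hgt
  · right
    have hlen : A.length + A'.length = C.length := by simpa using hs.2.2.length_eq
    have hfC : fblock f.1 P'.length = C := (agree _ hlt).trans hgP'
    have h0 := List.length_pos_iff.mpr hA
    have h0' := List.length_pos_iff.mpr hA'
    have hag : ∀ k < P'.length, fblock f'.1 k = fblock f.1 k := fun k hk => by
      rw [agree' k hk, agree k (by omega)]
    have hl : (fblock f'.1 P'.length).length < (fblock f.1 P'.length).length := by
      rw [hfP', hfC]; omega
    rcases hP _ hlt with ⟨hfol, -⟩ | ⟨-, h1⟩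
    · refine (hadm f' f P'.length hag fun h => by rw [h] at hl; exact lt_irrefl _ hl).1
        (hfol.mono (fun k hk => (hag k hk).symm) fun x hx => ⟨x, ?_, le_rfl⟩) hfol hl
      rw [hfC]
      exact hs.1.subset (hfP' ▸ hx)
    · rw [hfC] at h1
      omega
  · obtain ⟨rfl, hcons⟩ := List.append_inj hgg heq.symm
    obtain ⟨rfl, rfl⟩ := List.cons.inj hcons
    rcases lt_headL_or_eq_of_isShuffle hA hB hs with hlt | ⟨rfl, rfl⟩
    · exact Or.inr (key le_rfl (by rwa [hfP']))
    · exact Or.inl (Subtype.ext (hf'.trans hf.symm))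
  · right
    refine key hgt.le ?_
    rw [agree' _ hgt, hgP]
    cases B with
    | nil => exact absurd rfl hB0
    | cons x B => exact hB x (by simp)

theorem coface_eq_or_lt (hadm : Admissible n r)
    (hf : f.1 = P ++ [a] :: B :: S) (hg : g.1 = P ++ (B ++ [a]) :: S)
    (hgX : g ∈ descSet n w)
    (hB : ∀ x ∈ B, a < x) (hna : ¬IsFollower f.1 P.length)
    (hP : ∀ k < P.length, IsRigid w f.1 k) {g' : SymbolOn n} (hgX' : g' ∈ descSet n w)
    (h : IsFaceL f.1 g'.1) : g' = g ∨ r g g' := by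
  obtain ⟨P', A, A', C, S', hf', hg', hs⟩ := h.exists_eq
  have hB0 : B ≠ [] := f.2.1 B (by simp [hf])
  have hA : A ≠ [] := f.2.1 A (by simp [hf'])
  have hA' : A' ≠ [] := f.2.1 A' (by simp [hf'])
  obtain ⟨hCw, hCc⟩ := hgX' C (by simp [hg'])
  have hlen : A.length + A'.length = C.length := by simpa using hs.2.2.length_eq
  have h0 := List.length_pos_iff.mpr hA
  have h0' := List.length_pos_iff.mpr hA'
  have hff := hf.symm.trans hf'
  have hfa : fblock f.1 P.length = [a] := by rw [hf, fblock_append_length]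
  have hgP : fblock g.1 P.length = B ++ [a] := by rw [hg, fblock_append_length]
  have hgP' : fblock g'.1 P'.length = C := by rw [hg', fblock_append_length]
  have hfP' : fblock f.1 P'.length = A := by rw [hf', fblock_append_length]
  have hfS' : fblock f.1 (P'.length + 1) = A' := by rw [hf', fblock_append_length_succ]
  have agree : ∀ k < P.length, fblock f.1 k = fblock g.1 k := fun k hk => by
    rw [hf, hg, fblock_append_left hk, fblock_append_left hk]
  have agree' : ∀ k < P'.length, fblock f.1 k = fblock g'.1 k := fun k hk => by
    rw [hf', hg', fblock_append_left hk, fblock_append_left hk]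
  rcases lt_trichotomy P'.length P.length with hlt | heq | hgt
  · right
    have hag : ∀ k < P'.length, fblock g.1 k = fblock g'.1 k := fun k hk => by
      rw [← agree' k hk, agree k (by omega)]
    have hgA : fblock g.1 P'.length = A := by rw [← agree _ hlt, hfP']
    have hrig := hP _ hlt
    rw [IsRigid, hfP'] at hrig
    obtain ⟨hnf, hA1⟩ := hrig.resolve_left (by rintro ⟨-, h⟩; omega)
    have hsucc : ¬IsFollower f.1 (P'.length + 1) ∧ A'.length = 1 := by
      rcases Nat.lt_or_ge (P'.length + 1) P.length with hlt' | hge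
      · have hrig' := hP _ hlt'
        rw [IsRigid, hfS'] at hrig'
        exact hrig'.resolve_left (by rintro ⟨-, h⟩; omega)
      · have heq : P'.length + 1 = P.length := by omega
        refine ⟨by rwa [heq], ?_⟩
        rw [← hfS', heq, hfa]
        rfl
    obtain ⟨hnf', hA1'⟩ := hsucc
    obtain ⟨c, rfl⟩ := List.length_eq_one_iff.mp hA1
    obtain ⟨d, rfl⟩ := List.length_eq_one_iff.mp hA1'
    have hdc : d ≤ c := by
      by_contra hcd
      exact hnf' ⟨P'.length, rfl, c, hfP', by simpa [hfS'] using hcd⟩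
    have hnod : c ≠ d := by
      have hnd : C.Pairwise (· > ·) := List.isChain_iff_pairwise.mp hCc
      have := hs.2.2.nodup_iff.mpr (hnd.imp fun h => ne_of_gt h)
      simpa using this
    have hCeq : C = [c, d] :=
      (eq_of_perm_of_isChain_gt hs.2.2 (by simp; omega) hCc).symm
    subst hCeq
    have hng : ¬IsFollower g.1 P'.length := fun h =>
      hnf ((isFollower_congr fun k hk => (agree k (by omega)).symm).mp h)
    refine (hadm g g' P'.length hag (by simp [hgA, hgP'])).2.2.1 hng (fun h => hng ?_)
      (by simp [hgA, hgP', headL]) (by simp [hgA, hgP'])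
    exact h.mono (fun k hk => (hag k hk).symm) fun x hx =>
      ⟨x, by rw [hgA] at hx; rw [hgP']; simp at hx; simp [hx], le_rfl⟩
  · left
    obtain ⟨rfl, hcons⟩ := List.append_inj hff heq.symm
    simp only [List.cons.injEq] at hcons
    obtain ⟨rfl, rfl, rfl⟩ := hcons
    have hC : C = B ++ [a] :=
      eq_of_perm_of_isChain_gt
        (hs.2.2.symm.trans (isShuffle_append_singleton a B).2.2) hCc
        (hgX _ (by simp [hg])).2
    exact Subtype.ext (by rw [hg', hg, hC])
  · right
    have hga : fblock g'.1 P.length = [a] := by rw [← agree' _ hgt, hfa]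
    have hag : ∀ k < P.length, fblock g.1 k = fblock g'.1 k := fun k hk => by
      rw [← agree' k (by omega), agree k hk]
    have hng' : ¬IsFollower g'.1 P.length := fun h =>
      hna ((isFollower_congr fun k hk => (agree' k (by omega)).symm).mp h)
    have hlt : a < headL (B ++ [a]) := by
      cases B with
      | nil => exact absurd rfl hB0
      | cons x B => exact hB x (by simp)
    refine (hadm g g' P.length hag (by simp [hgP, hga, hB0])).2.1 (fun h => hng' ?_) hng'
      (by rw [hga, hgP]; exact hlt)
    exact h.mono hag fun x hx => ⟨x, by rw [hga] at hx; rw [hgP]; simp at hx; simp [hx], le_rfl⟩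

/-- If all blocks before a non-follower `[a]` are rigid, splitting off the minimum `a` of
`B ++ [a]` is a pair of the vector field. -/
theorem paired_of_isRigid (hadm : Admissible n r)
    (hf : f.1 = P ++ [a] :: B :: S) (hg : g.1 = P ++ (B ++ [a]) :: S)
    (hfX : f ∈ descSet n w) (hgX : g ∈ descSet n w)
    (hB : ∀ x ∈ B, a < x) (hna : ¬IsFollower f.1 P.length)
    (hP : ∀ k < P.length, IsRigid w f.1 k) : Paired n r (descSet n w) f g := by
  refine ⟨hfX, hgX, ?_, fun f' h => face_eq_or_lt hadm hf hg hB hna hP h,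
    fun g' hX h => coface_eq_or_lt hadm hf hg hgX hB hna hP hX h⟩
  rw [hf, hg]
  exact isFaceL_append P S (isShuffle_append_singleton a B)

end Pairing

theorem isSymbolOn_merge_iff {n a : ℕ} {P S : List (List ℕ)} {B : List ℕ} (hB : B ≠ []) :
    IsSymbolOn n (P ++ [a] :: B :: S) ↔ IsSymbolOn n (P ++ (B ++ [a]) :: S) := by
  have hp : (P ++ [a] :: B :: S).flatten.Perm (P ++ (B ++ [a]) :: S).flatten := by
    simp only [List.flatten_append, List.flatten_cons, ← List.append_assoc]
    refine List.Perm.append_right _ ?_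
    simp only [List.append_assoc]
    exact (List.perm_append_comm).append_left _
  refine and_congr ?_ ⟨hp.symm.trans, hp.trans⟩
  simp [or_imp, forall_and, hB]

theorem Critical.isRigid {n w : ℕ} (hw : 2 ≤ w) {r : SymbolOn n → SymbolOn n → Prop}
    (hadm : Admissible n r) {e : SymbolOn n} (he : Critical n r (descSet n w) e) (i : ℕ)
    (hi : i < e.1.length) : IsRigid w e.1 i := by
  induction i using Nat.strong_induction_on with
  | _ i ih =>
  have hrig : ∀ k < i, IsRigid w e.1 k := fun k hk => ih k hk (hk.trans hi)
  obtain ⟨heX, hef, heg⟩ := he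
  by_contra hbad
  have hpos := List.length_pos_iff.mpr (e.2.1 _ (fblock_mem hi))
  have hle := (heX _ (fblock_mem hi)).1
  have hchain : (fblock e.1 i).Pairwise (· > ·) :=
    List.isChain_iff_pairwise.mp (heX _ (fblock_mem hi)).2
  have hdec := take_append_fblock_cons_drop hi
  by_cases hfol : IsFollower e.1 i
  · have hlt : (fblock e.1 i).length < w :=
      lt_of_le_of_ne hle fun h => hbad (Or.inl ⟨hfol, h⟩)
    obtain ⟨j, rfl, a, ha, hB⟩ := hfol
    have hj : j < e.1.length := by omega
    have hPl : (e.1.take j).length = j := by simp; omega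
    have hdec' : e.1 = e.1.take j ++ [a] :: fblock e.1 (j + 1) :: e.1.drop (j + 1 + 1) := by
      conv_lhs => rw [← take_append_fblock_cons_drop hj, ha]
      simp [fblock, List.getElem?_eq_getElem hi]
    have hB0 : fblock e.1 (j + 1) ≠ [] := List.length_pos_iff.mp hpos
    have hnj : ¬IsFollower e.1 j := by
      have := hrig j (by omega)
      rw [IsRigid, ha] at this
      exact (this.resolve_left (by rintro ⟨-, h⟩; simp at h; omega)).1
    have hsym := e.2
    rw [hdec', isSymbolOn_merge_iff hB0] at hsym
    refine hef ⟨_, hsym⟩ (paired_of_isRigid hadm hdec' rfl heX ?_ hB (by rwa [hPl])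
      fun k hk => hrig k (by omega))
    intro b hb
    rcases List.mem_append.mp hb with hb | hb
    · exact heX b (List.mem_of_mem_take hb)
    rcases List.mem_cons.mp hb with rfl | hb
    · refine ⟨by simp; omega, ?_⟩
      exact List.isChain_iff_pairwise.mpr
        (List.pairwise_append.mpr ⟨hchain, by simp, by simpa using hB⟩)
    · exact heX b (List.mem_of_mem_drop hb)
  · have h2 : (fblock e.1 i).length ≠ 1 := fun h => hbad (Or.inr ⟨hfol, h⟩)
    obtain ⟨B, a, hBa⟩ : ∃ B a, fblock e.1 i = B ++ [a] :=
      ⟨_, _, (List.dropLast_append_getLast (List.length_pos_iff.mp hpos)).symm⟩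
    have hB0 : B ≠ [] := by
      rintro rfl
      simp [hBa] at h2
    have hPl : (e.1.take i).length = i := by simp; omega
    rw [hBa, List.pairwise_append] at hchain
    obtain ⟨hBc, -, hlt⟩ := hchain
    have hlt' : ∀ x ∈ B, a < x := fun x hx => hlt x hx a (by simp)
    rw [hBa] at hdec hle
    have hsym := e.2
    rw [← hdec, ← isSymbolOn_merge_iff hB0] at hsym
    have agree : ∀ k < i, fblock (e.1.take i ++ [a] :: B :: e.1.drop (i + 1)) k =
        fblock e.1 k := fun k hk => by
      conv_rhs => rw [← hdec]
      rw [fblock_append_left (by omega), fblock_append_left (by omega)]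
    refine heg ⟨_, hsym⟩ (paired_of_isRigid hadm rfl hdec.symm ?_ heX hlt' ?_ ?_)
    · intro b hb
      rcases List.mem_append.mp hb with hb | hb
      · exact heX b (List.mem_of_mem_take hb)
      rcases List.mem_cons.mp hb with rfl | hb
      · exact ⟨by simp; omega, List.isChain_singleton a⟩
      rcases List.mem_cons.mp hb with rfl | hb
      · exact ⟨by simp at hle; omega, List.isChain_iff_pairwise.mpr hBc⟩
      · exact heX b (List.mem_of_mem_drop hb)
    · intro h
      have hfa := fblock_append_length (e.1.take i) (B :: e.1.drop (i + 1)) [a]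
      rw [hPl] at h hfa
      refine hfol (h.mono agree fun x hx => ⟨a, by rw [hfa]; simp, ?_⟩)
      rw [hBa] at hx
      rcases List.mem_append.mp hx with hx | hx
      · exact (hlt' x hx).le
      · exact (List.mem_singleton.mp hx).ge
    · intro k hk
      exact (isRigid_congr fun j hj => agree j (by omega)).mpr (hrig k (by omega))

theorem stmt11 (n w : ℕ) (hw : 2 ≤ w) (r : SymbolOn n → SymbolOn n → Prop)
    (hr : IsStrictTotalOrder (SymbolOn n) r) (hadm : Admissible n r)
    (e : SymbolOn n) (he : Critical n r (descSet n w) e) :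
    (∀ i a b, fblock e.1 i = [a] → fblock e.1 (i + 1) = [b] → b < a) ∧
    (∀ i, 2 ≤ (fblock e.1 i).length →
      (fblock e.1 i).length = w ∧ IsFollower e.1 i) := by
  refine ⟨fun i a b ha hb => ?_, fun i h2 => ?_⟩
  · have hi : i + 1 < e.1.length := lt_length_of_fblock_ne_nil (by simp [hb])
    have hrig := he.isRigid hw hadm (i + 1) hi
    rw [IsRigid, hb] at hrig
    have hnf := (hrig.resolve_left (by rintro ⟨-, h⟩; simp at h; omega)).1
    have hle : b ≤ a := by
      by_contra hab
      exact hnf ⟨i, rfl, a, ha, by simpa [hb] using hab⟩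
    refine lt_of_le_of_ne hle ?_
    rintro rfl
    have hnd : e.1.flatten.Nodup := e.2.2.nodup_iff.mpr List.nodup_range'
    have hpw := (List.nodup_flatten.mp hnd).2
    have hdis := List.pairwise_iff_getElem.mp hpw i (i + 1) (by omega) hi (by omega)
    have hbi : e.1[i] = [b] := by
      simpa [fblock, List.getElem?_eq_getElem (show i < e.1.length by omega)] using ha
    have hbi' : e.1[i + 1] = [b] := by
      simpa [fblock, List.getElem?_eq_getElem hi] using hb
    simp [hbi, hbi'] at hdis
  · have hi : i < e.1.length := lt_length_of_fblock_ne_nil (by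
      intro h
      simp [h] at h2)
    rcases he.isRigid hw hadm i hi with ⟨hfol, hl⟩ | ⟨-, hl⟩
    · exact ⟨hl, hfol⟩
    · omega
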